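/- arXiv:1705.00020 — 4 statements merged into one kernel-verified Lean document; each statement's English description precedes it below -/
import Mathlib

section
/- Let v¹, v², v³, v⁴ : ℝ² → ℝ² be functions that are differentiable at the origin, and suppose there exists r > 0 such that v¹ = v⁴ on the segment {(x,0) : 0 ≤ x < r}, v¹ = v² on {(0,y) : 0 ≤ y < r}, v³ = v² on {(x,0) : −r < x ≤ 0}, and v³ = v⁴ on {(0,y) : −r < y ≤ 0}. Then −div v¹(0) + div v²(0) − div v³(0) + div v⁴(0) = 0. -/
/-- The divergence of a vector field `w : ℝ² → ℝ²` at a point `p`: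
`div w(p) = ∂₁w₁(p) + ∂₂w₂(p)`. -/
noncomputable def div2 (w : ℝ × ℝ → ℝ × ℝ) (p : ℝ × ℝ) : ℝ :=
  (fderiv ℝ w p (1, 0)).1 + (fderiv ℝ w p (0, 1)).2

open Filter Topology in
/-- Two maps differentiable at `a` that agree on a half-open segment issuing from `a` in the
direction `e` have the same derivative at `a` in the direction `e`. -/
theorem fderiv_apply_eq_of_eq_on_segment {E F : Type*} [NormedAddCommGroup E] [NormedSpace ℝ E]
    [NormedAddCommGroup F] [NormedSpace ℝ F] {f g : E → F} {a e : E} {r : ℝ}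
    (hf : DifferentiableAt ℝ f a) (hg : DifferentiableAt ℝ g a) (hr : 0 < r)
    (h : ∀ t : ℝ, 0 ≤ t → t < r → f (a + t • e) = g (a + t • e)) :
    fderiv ℝ f a e = fderiv ℝ g a e := by
  have hf' : HasDerivAt (fun t : ℝ => f (a + t • e)) (fderiv ℝ f a e) 0 :=
    hf.hasFDerivAt.hasLineDerivAt e
  have hg' : HasDerivAt (fun t : ℝ => g (a + t • e)) (fderiv ℝ g a e) 0 :=
    hg.hasFDerivAt.hasLineDerivAt e
  have heq : (fun t : ℝ => f (a + t • e)) =ᶠ[𝓝[Set.Ici 0] 0] fun t => g (a + t • e) := by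
    filter_upwards [Ico_mem_nhdsGE hr] with t ht using h t ht.1 ht.2
  exact (uniqueDiffWithinAt_Ici (0 : ℝ)).eq_deriv _ hf'.hasDerivWithinAt
    (hg'.hasDerivWithinAt.congr_of_eventuallyEq heq (heq.self_of_nhdsWithin Set.self_mem_Ici))

/-- If `v¹, v², v³, v⁴ : ℝ² → ℝ²` are differentiable at the origin, `v¹ = v⁴` on
`{(x,0) : 0 ≤ x < r}`, `v¹ = v²` on `{(0,y) : 0 ≤ y < r}`, `v³ = v²` on
`{(x,0) : −r < x ≤ 0}` and `v³ = v⁴` on `{(0,y) : −r < y ≤ 0}` for some `r > 0`, then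
`−div v¹(0) + div v²(0) − div v³(0) + div v⁴(0) = 0`. -/
theorem alternating_sum_div_eq_zero (v1 v2 v3 v4 : ℝ × ℝ → ℝ × ℝ)
    (h1 : DifferentiableAt ℝ v1 0) (h2 : DifferentiableAt ℝ v2 0)
    (h3 : DifferentiableAt ℝ v3 0) (h4 : DifferentiableAt ℝ v4 0)
    (hr : ∃ r : ℝ, 0 < r ∧
      (∀ x : ℝ, 0 ≤ x → x < r → v1 (x, 0) = v4 (x, 0)) ∧
      (∀ y : ℝ, 0 ≤ y → y < r → v1 (0, y) = v2 (0, y)) ∧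
      (∀ x : ℝ, -r < x → x ≤ 0 → v3 (x, 0) = v2 (x, 0)) ∧
      (∀ y : ℝ, -r < y → y ≤ 0 → v3 (0, y) = v4 (0, y))) :
    -div2 v1 0 + div2 v2 0 - div2 v3 0 + div2 v4 0 = 0 := by
  obtain ⟨r, hr, h14, h12, h32, h34⟩ := hr
  have e14 : fderiv ℝ v1 0 (1, 0) = fderiv ℝ v4 0 (1, 0) :=
    fderiv_apply_eq_of_eq_on_segment h1 h4 hr fun t ht htr => by simpa using h14 t ht htr
  have e12 : fderiv ℝ v1 0 (0, 1) = fderiv ℝ v2 0 (0, 1) :=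
    fderiv_apply_eq_of_eq_on_segment h1 h2 hr fun t ht htr => by simpa using h12 t ht htr
  have e32 : fderiv ℝ v3 0 (1, 0) = fderiv ℝ v2 0 (1, 0) := by
    have h := fderiv_apply_eq_of_eq_on_segment (e := -(1, 0)) h3 h2 hr fun t ht htr => by
      simpa using h32 (-t) (by linarith) (by linarith)
    rwa [map_neg, map_neg, neg_inj] at h
  have e34 : fderiv ℝ v3 0 (0, 1) = fderiv ℝ v4 0 (0, 1) := by
    have h := fderiv_apply_eq_of_eq_on_segment (e := -(0, 1)) h3 h4 hr fun t ht htr => by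
      simpa using h34 (-t) (by linarith) (by linarith)
    rwa [map_neg, map_neg, neg_inj] at h
  simp only [div2, e14, e12, e32, e34]
  ring
end

section
/- For every integer k ≥ 3, the real vector space B^k(T̂) = {v ∈ (P^k)² : v vanishes on ∂T̂} has dimension (k−2)(k−1). For k ≤ 2, B^k(T̂) = {0}. -/
open MvPolynomial

/-- `(x,y)` lies on the boundary of the reference triangle
`T̂ = {x ≥ 0, y ≥ 0, x + y ≤ 1}`. -/
def OnBdryT (x y : ℝ) : Prop :=
  0 ≤ x ∧ 0 ≤ y ∧ x + y ≤ 1 ∧ (x = 0 ∨ y = 0 ∨ x + y = 1)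

/-- `B^k(T̂)`: the space of pairs of real polynomials in two variables, each of total
degree at most `k`, vanishing at every point of the boundary of the reference triangle. -/
noncomputable def Bspace (k : ℕ) :
    Submodule ℝ (MvPolynomial (Fin 2) ℝ × MvPolynomial (Fin 2) ℝ) where
  carrier := {v | v.1.totalDegree ≤ k ∧ v.2.totalDegree ≤ k ∧
    ∀ x y : ℝ, OnBdryT x y → eval ![x, y] v.1 = 0 ∧ eval ![x, y] v.2 = 0}
  zero_mem' := by simp
  add_mem' := by
    rintro a b ⟨ha1, ha2, ha3⟩ ⟨hb1, hb2, hb3⟩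
    refine ⟨le_trans (totalDegree_add _ _) (max_le ha1 hb1),
      le_trans (totalDegree_add _ _) (max_le ha2 hb2), ?_⟩
    intro x y hxy
    obtain ⟨e1, e2⟩ := ha3 x y hxy
    obtain ⟨f1, f2⟩ := hb3 x y hxy
    simp [e1, e2, f1, f2]
  smul_mem' := by
    rintro c a ⟨ha1, ha2, ha3⟩
    refine ⟨le_trans (totalDegree_smul_le _ _) ha1,
      le_trans (totalDegree_smul_le _ _) ha2, ?_⟩
    intro x y hxy
    obtain ⟨e1, e2⟩ := ha3 x y hxy
    simp [smul_eval, e1, e2]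

/-- If `p` vanishes on a piece of the curve parametrized by the polynomials `q`, where `l`
divides `X i - q i (X j)` for all `i`, then `l` divides `p`. -/
theorem dvd_of_eval_parametrization_eq_zero {σ : Type*} {l p : MvPolynomial σ ℝ} (j : σ)
    (q : σ → Polynomial ℝ) (hl : ∀ i, l ∣ X i - Polynomial.aeval (X j) (q i))
    (hp : ∀ t ∈ Set.Ioo (0 : ℝ) 1, eval (fun i => (q i).eval t) p = 0) : l ∣ p := by
  have hq : aeval q p = 0 := by
    refine Polynomial.eq_zero_of_infinite_isRoot _ ((Set.Ioo_infinite zero_lt_one).mono ?_)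
    intro t ht
    have h : (Polynomial.aeval t).comp (aeval q) = aeval (R := ℝ) (fun i => (q i).eval t) := by
      ext i
      simp
    have h' := DFunLike.congr_fun h p
    simp only [AlgHom.comp_apply, Polynomial.coe_aeval_eq_eval, aeval_eq_eval] at h'
    exact h'.trans (hp t ht)
  have h : (Ideal.Quotient.mkₐ ℝ (Ideal.span {l})) = ((Ideal.Quotient.mkₐ ℝ (Ideal.span {l})).comp
      (Polynomial.aeval (X j))).comp (aeval q) := by
    ext i
    simpa [Ideal.Quotient.eq, Ideal.mem_span_singleton] using hl i
  have h' := DFunLike.congr_fun h p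
  rw [AlgHom.comp_apply, hq, map_zero] at h'
  simpa [Ideal.Quotient.eq_zero_iff_mem, Ideal.mem_span_singleton] using h'

/-- The cubic bubble function `x y (1 - x - y)` of the reference triangle. -/
noncomputable def bubble : MvPolynomial (Fin 2) ℝ := X 0 * X 1 * (1 - X 0 - X 1)

theorem bubble_dvd {p : MvPolynomial (Fin 2) ℝ}
    (hp : ∀ x y : ℝ, OnBdryT x y → eval ![x, y] p = 0) : bubble ∣ p := by
  have h0 : X 0 ∣ p := by
    refine dvd_of_eval_parametrization_eq_zero 1 ![0, Polynomial.X] ?_ ?_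
    · simp [Fin.forall_fin_two]
    · rintro t ⟨ht0, ht1⟩
      convert hp 0 t ⟨le_rfl, ht0.le, by linarith, by simp⟩ using 3
      ext i
      fin_cases i <;> simp
  obtain ⟨r, rfl⟩ := h0
  have h1 : X 1 ∣ r := by
    refine dvd_of_eval_parametrization_eq_zero 0 ![Polynomial.X, 0] ?_ ?_
    · simp [Fin.forall_fin_two]
    · rintro t ⟨ht0, ht1⟩
      have h := hp t 0 ⟨ht0.le, le_rfl, by linarith, by simp⟩
      simp only [map_mul, eval_X, Matrix.cons_val_zero, mul_eq_zero, ht0.ne', false_or] at h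
      convert h using 3
      ext i
      fin_cases i <;> simp
  obtain ⟨s, rfl⟩ := h1
  have h2 : 1 - X 0 - X 1 ∣ s := by
    refine dvd_of_eval_parametrization_eq_zero 1 ![1 - Polynomial.X, Polynomial.X] ?_ ?_
    · simp only [Fin.forall_fin_two]
      exact ⟨⟨-1, by simp; ring⟩, by simp⟩
    · rintro t ⟨ht0, ht1⟩
      have h := hp (1 - t) t ⟨by linarith, ht0.le, by linarith, by simp⟩
      simp only [map_mul, eval_X, Matrix.cons_val_zero, Matrix.cons_val_one, mul_eq_zero, ht0.ne',
        (sub_pos.2 ht1).ne', false_or] at h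
      convert h using 3
      ext i
      fin_cases i <;> simp
  obtain ⟨u, rfl⟩ := h2
  exact ⟨u, by simp only [bubble]; ring⟩

theorem eval_bubble {x y : ℝ} (h : OnBdryT x y) : eval ![x, y] bubble = 0 := by
  obtain ⟨-, -, -, h | h | h⟩ := h
  · simp [bubble, h]
  · simp [bubble, h]
  · simp [bubble, sub_sub, h]

theorem coeff_one_sub_X_sub_X :
    coeff (Finsupp.single 0 1) (1 - X 0 - X 1 : MvPolynomial (Fin 2) ℝ) = -1 := by
  simp [coeff_X, coeff_one, Finsupp.single_left_inj, (Finsupp.single_ne_zero.2 one_ne_zero).symm]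

theorem one_sub_X_sub_X_ne_zero : (1 - X 0 - X 1 : MvPolynomial (Fin 2) ℝ) ≠ 0 := by
  intro h
  simpa [h] using coeff_one_sub_X_sub_X

theorem totalDegree_one_sub_X_sub_X :
    (1 - X 0 - X 1 : MvPolynomial (Fin 2) ℝ).totalDegree = 1 := by
  apply le_antisymm
  · refine (totalDegree_sub _ _).trans (max_le ((totalDegree_sub _ _).trans ?_) ?_) <;> simp
  · have h := le_totalDegree (p := (1 - X 0 - X 1 : MvPolynomial (Fin 2) ℝ))
      (s := Finsupp.single 0 1) (by rw [mem_support_iff, coeff_one_sub_X_sub_X]; norm_num)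
    simpa using h

theorem bubble_ne_zero : bubble ≠ 0 :=
  mul_ne_zero (mul_ne_zero (X_ne_zero 0) (X_ne_zero 1)) one_sub_X_sub_X_ne_zero

theorem totalDegree_bubble : bubble.totalDegree = 3 := by
  rw [bubble, totalDegree_mul_of_isDomain (mul_ne_zero (X_ne_zero 0) (X_ne_zero 1))
    one_sub_X_sub_X_ne_zero, totalDegree_mul_of_isDomain (X_ne_zero 0) (X_ne_zero 1),
    totalDegree_one_sub_X_sub_X, totalDegree_X, totalDegree_X]

theorem totalDegree_bubble_mul {q : MvPolynomial (Fin 2) ℝ} (hq : q ≠ 0) :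
    (bubble * q).totalDegree = q.totalDegree + 3 := by
  rw [totalDegree_mul_of_isDomain bubble_ne_zero hq, totalDegree_bubble, add_comm]

theorem totalDegree_bubble_mul_le_iff {q : MvPolynomial (Fin 2) ℝ} {m : ℕ} :
    (bubble * q).totalDegree ≤ m + 3 ↔ q.totalDegree ≤ m := by
  rcases eq_or_ne q 0 with rfl | hq
  · simp
  · rw [totalDegree_bubble_mul hq, Nat.add_le_add_iff_right]

/-- Multiplication of both components by the bubble function. -/
noncomputable def bubbleMul (m : ℕ) :
    (restrictTotalDegree (Fin 2) ℝ m × restrictTotalDegree (Fin 2) ℝ m) →ₗ[ℝ]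
      (MvPolynomial (Fin 2) ℝ × MvPolynomial (Fin 2) ℝ) :=
  (LinearMap.mulLeft ℝ bubble ∘ₗ Submodule.subtype _).prodMap
    (LinearMap.mulLeft ℝ bubble ∘ₗ Submodule.subtype _)

theorem bubbleMul_injective (m : ℕ) : Function.Injective (bubbleMul m) :=
  have h := (mul_right_injective₀ bubble_ne_zero).comp
    (Submodule.subtype_injective (restrictTotalDegree (Fin 2) ℝ m))
  h.prodMap h

theorem range_bubbleMul (m : ℕ) : LinearMap.range (bubbleMul m) = Bspace (m + 3) := by
  ext ⟨p, q⟩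
  constructor
  · rintro ⟨⟨⟨r, hr⟩, ⟨s, hs⟩⟩, h⟩
    rw [mem_restrictTotalDegree] at hr hs
    obtain ⟨rfl, rfl⟩ := Prod.mk.inj h
    exact ⟨totalDegree_bubble_mul_le_iff.2 hr, totalDegree_bubble_mul_le_iff.2 hs,
      fun x y hxy => by simp [eval_bubble hxy]⟩
  · rintro ⟨hp, hq, h⟩
    obtain ⟨r, rfl⟩ := bubble_dvd fun x y hxy => (h x y hxy).1
    obtain ⟨s, rfl⟩ := bubble_dvd fun x y hxy => (h x y hxy).2
    exact ⟨(⟨r, (mem_restrictTotalDegree _ _ _).2 (totalDegree_bubble_mul_le_iff.1 hp)⟩,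
      ⟨s, (mem_restrictTotalDegree _ _ _).2 (totalDegree_bubble_mul_le_iff.1 hq)⟩), rfl⟩

theorem eq_zero_of_totalDegree_le_two {p : MvPolynomial (Fin 2) ℝ} (hd : p.totalDegree ≤ 2)
    (hp : ∀ x y : ℝ, OnBdryT x y → eval ![x, y] p = 0) : p = 0 := by
  obtain ⟨q, rfl⟩ := bubble_dvd hp
  by_contra h
  have := totalDegree_bubble_mul (right_ne_zero_of_mul h)
  omega

theorem finrank_restrictTotalDegree_fin_two (R : Type*) [CommRing R] [Nontrivial R] (m : ℕ) :
    2 * Module.finrank R (restrictTotalDegree (Fin 2) R m) = (m + 1) * (m + 2) := by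
  let e : {n : Fin 2 →₀ ℕ | (n.sum fun _ e => e) ≤ m} ≃ Σ i : Fin (m + 1), Fin (i + 1) :=
    { toFun := fun n => ⟨⟨n.1 0 + n.1 1, by
          have h : (n.1.sum fun _ e => e) ≤ m := n.2
          rw [Finsupp.sum_fintype _ _ (fun _ => rfl), Fin.sum_univ_two] at h
          omega⟩, ⟨n.1 0, by simp only; omega⟩⟩
      invFun := fun x => ⟨Finsupp.equivFunOnFinite.symm ![(x.2 : ℕ), x.1 - x.2], by
          have h1 := x.1.2
          have h2 := x.2.2
          simp only [Set.mem_ofPred_eq]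
          rw [Finsupp.sum_fintype _ _ (fun _ => rfl), Fin.sum_univ_two]
          simp
          omega⟩
      left_inv := by
        rintro ⟨n, hn⟩
        ext i
        fin_cases i <;> simp
      right_inv := by
        rintro ⟨⟨i, hi⟩, ⟨j, hj⟩⟩
        have h : j + (i - j) = i := Nat.add_sub_cancel' (Nat.lt_succ_iff.1 hj)
        refine Sigma.ext (Fin.ext h) ?_
        exact (Fin.heq_ext_iff (congrArg (· + 1) h)).2 rfl }
  rw [restrictTotalDegree, Module.finrank_eq_nat_card_basis (basisRestrictSupport R _),
    Nat.card_congr e, Nat.card_eq_fintype_card, Fintype.card_sigma]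
  simp only [Fintype.card_fin]
  rw [Fin.sum_univ_eq_sum_range (fun i => i + 1)]
  clear e
  induction m with
  | zero => rfl
  | succ m ih =>
    rw [Finset.sum_range_succ, mul_add, ih]
    ring

/-- For `k ≥ 3`, the space `B^k(T̂)` of polynomial vector fields of degree at most `k`
vanishing on the boundary of the reference triangle has dimension `(k−2)(k−1)`, and for
`k ≤ 2` it is the zero space. -/
theorem dim_Bspace (k : ℕ) :
    (3 ≤ k → Module.finrank ℝ (Bspace k) = (k - 2) * (k - 1)) ∧
    (k ≤ 2 → Bspace k = ⊥) := by
  constructor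
  · intro hk
    obtain ⟨m, rfl⟩ := Nat.exists_eq_add_of_le' hk
    rw [← range_bubbleMul, LinearMap.finrank_range_of_inj (bubbleMul_injective m),
      Module.finrank_prod, ← two_mul, finrank_restrictTotalDegree_fin_two]
    rfl
  · intro hk
    rw [eq_bot_iff]
    rintro ⟨p, q⟩ ⟨hp, hq, h⟩
    exact Prod.ext (eq_zero_of_totalDegree_le_two (hp.trans hk) fun x y hxy => (h x y hxy).1)
      (eq_zero_of_totalDegree_le_two (hq.trans hk) fun x y hxy => (h x y hxy).2)
end

section
/- Let k ≥ 1 and let v = (v₁,v₂) be a pair of real polynomials in two variables, each of total degree at most k, such that v vanishes at every point of the boundary ∂T̂ of the reference triangle. Then div v = ∂₁v₁ + ∂₂v₂ belongs to M^{k−1}(T̂): it is a polynomial of total degree at most k−1 that vanishes at the three vertices (0,0), (1,0), (0,1) and satisfies ∫_{T̂} div v dx dy = 0. -/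
open MvPolynomial MeasureTheory

/-- The reference triangle `T̂ = {(x,y) : x ≥ 0, y ≥ 0, x + y ≤ 1}`. -/
def Tref : Set (ℝ × ℝ) := {p | 0 ≤ p.1 ∧ 0 ≤ p.2 ∧ p.1 + p.2 ≤ 1}

/-- A partial derivative lowers the total degree by at least one. -/
theorem totalDegree_pderiv_le {σ R : Type*} [CommSemiring R] (i : σ) (p : MvPolynomial σ R) :
    (pderiv i p).totalDegree ≤ p.totalDegree - 1 := by
  classical
  refine Finset.sup_le fun m hm => ?_
  rw [mem_support_iff, coeff_pderiv] at hm
  have hmem : m + Finsupp.single i 1 ∈ p.support :=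
    mem_support_iff.2 fun h => hm (by simp [h])
  have hle := le_totalDegree hmem
  rw [Finsupp.sum_add_index' (fun _ => rfl) (fun _ _ _ => rfl),
    Finsupp.sum_single_index rfl] at hle
  omega

/-- The chain rule for a bivariate polynomial along a differentiable curve. -/
theorem hasDerivAt_eval_fin_two (p : MvPolynomial (Fin 2) ℝ) {x y : ℝ → ℝ} {x' y' t : ℝ}
    (hx : HasDerivAt x x' t) (hy : HasDerivAt y y' t) :
    HasDerivAt (fun s => eval ![x s, y s] p)
      (x' * eval ![x t, y t] (pderiv 0 p) + y' * eval ![x t, y t] (pderiv 1 p)) t := by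
  induction p using MvPolynomial.induction_on with
  | C a => simpa using hasDerivAt_const t a
  | add p q hp hq =>
    simp only [map_add]
    exact (hp.add hq).congr_deriv (by ring)
  | mul_X p i hp =>
    have hi : HasDerivAt (fun s => ![x s, y s] i) (![x', y'] i) t := by
      fin_cases i
      · simpa using hx
      · simpa using hy
    simp only [map_mul, eval_X]
    refine (hp.mul hi).congr_deriv ?_
    fin_cases i <;> simp [pderiv_X] <;> ring

/-- If a bivariate polynomial vanishes on the segment from `(a, b)` in direction `(c, d)`, then
its derivative in that direction vanishes at `(a, b)`. -/
theorem directional_deriv_eq_zero (p : MvPolynomial (Fin 2) ℝ) (a b c d : ℝ)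
    (h : ∀ t ∈ Set.Icc (0 : ℝ) 1, eval ![a + t * c, b + t * d] p = 0) :
    c * eval ![a, b] (pderiv 0 p) + d * eval ![a, b] (pderiv 1 p) = 0 := by
  have hline (u v : ℝ) : HasDerivAt (fun t : ℝ => u + t * v) v 0 := by
    simpa using ((hasDerivAt_id (0 : ℝ)).mul_const v).const_add u
  have hderiv := hasDerivAt_eval_fin_two p (hline a c) (hline b d)
  simp only [zero_mul, add_zero] at hderiv
  have h0 : (0 : ℝ) ∈ Set.Icc (0 : ℝ) 1 := by simp
  exact (uniqueDiffOn_Icc zero_lt_one 0 h0).eq_deriv _ hderiv.hasDerivWithinAt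
    ((hasDerivWithinAt_const (0 : ℝ) _ (0 : ℝ)).congr h (h 0 h0))

theorem isCompact_Tref : IsCompact Tref := by
  refine (isCompact_Icc (a := ((0 : ℝ), (0 : ℝ))) (b := (1, 1))).of_isClosed_subset ?_ ?_
  · exact (isClosed_le continuous_const continuous_fst).inter
      ((isClosed_le continuous_const continuous_snd).inter
        (isClosed_le (continuous_fst.add continuous_snd) continuous_const))
  · rintro ⟨x, y⟩ ⟨hx, hy, hxy⟩
    simp only at hx hy hxy
    exact ⟨⟨hx, hy⟩, ⟨by dsimp only; linarith, by dsimp only; linarith⟩⟩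

theorem continuous_eval_fin_two {X : Type*} [TopologicalSpace X] (p : MvPolynomial (Fin 2) ℝ)
    {x y : X → ℝ} (hx : Continuous x) (hy : Continuous y) :
    Continuous fun t => eval ![x t, y t] p := by
  refine (MvPolynomial.continuous_eval p).comp (continuous_pi fun i => ?_)
  fin_cases i
  · exact hx
  · exact hy

theorem integrableOn_Tref {f : ℝ × ℝ → ℝ} (hf : Continuous f) : IntegrableOn f Tref :=
  hf.continuousOn.integrableOn_compact isCompact_Tref

/-- Reflection in the diagonal preserves the integral over the reference triangle. -/
theorem setIntegral_Tref_swap (f : ℝ × ℝ → ℝ) :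
    ∫ q in Tref, f q.swap = ∫ q in Tref, f q := by
  have hpre : Prod.swap ⁻¹' Tref = Tref := by
    ext ⟨x, y⟩
    simp only [Tref, Set.mem_preimage, Set.mem_ofPred_eq, Prod.swap, add_comm y x]
    tauto
  have := (Measure.measurePreserving_swap (μ := (volume : Measure ℝ))
    (ν := (volume : Measure ℝ))).setIntegral_preimage_emb
    MeasurableEquiv.prodComm.measurableEmbedding f Tref
  rwa [hpre] at this

/-- A continuous function whose integrals over the vertical sections of the reference triangle
vanish has zero integral over the triangle. -/
theorem setIntegral_Tref_eq_zero {f : ℝ × ℝ → ℝ} (hf : Continuous f)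
    (h : ∀ x ∈ Set.Icc (0 : ℝ) 1, ∫ y in (0 : ℝ)..(1 - x), f (x, y) = 0) :
    ∫ q in Tref, f q = 0 := by
  have hmeas : MeasurableSet Tref := isCompact_Tref.measurableSet
  rw [← integral_indicator hmeas, Measure.volume_eq_prod,
    integral_prod _ ((integrable_indicator_iff hmeas).2 (integrableOn_Tref hf))]
  refine integral_eq_zero_of_ae (Filter.Eventually.of_forall fun x => ?_)
  by_cases hx : x ∈ Set.Icc (0 : ℝ) 1
  · have hsec : (fun y => Tref.indicator f (x, y)) =
        (Set.Icc 0 (1 - x)).indicator fun y => f (x, y) := by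
      funext y
      refine Set.indicator_eq_indicator ?_ rfl
      simp only [Tref, Set.mem_ofPred_eq, Set.mem_Icc, hx.1, true_and, le_sub_iff_add_le']
    simp only [hsec, Pi.zero_apply]
    rw [integral_indicator measurableSet_Icc, integral_Icc_eq_integral_Ioc,
      ← intervalIntegral.integral_of_le (by linarith [hx.2]), h x hx]
  · have hsec : (fun y => Tref.indicator f (x, y)) = 0 := by
      funext y
      refine Set.indicator_of_notMem (fun hq => hx ⟨hq.1, ?_⟩) f
      have h1 := hq.2.1
      have h2 := hq.2.2
      simp only at h1 h2
      linarith
    simp [hsec]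

/-- The integral over the reference triangle of `∂₂ p` vanishes if `p` vanishes on the
boundary. -/
theorem setIntegral_Tref_pderiv_one (p : MvPolynomial (Fin 2) ℝ)
    (h : ∀ x y : ℝ, OnBdryT x y → eval ![x, y] p = 0) :
    ∫ q in Tref, eval ![q.1, q.2] (pderiv 1 p) = 0 := by
  refine setIntegral_Tref_eq_zero (continuous_eval_fin_two _ continuous_fst continuous_snd) fun x hx => ?_
  have hderiv (y : ℝ) : HasDerivAt (fun s => eval ![x, s] p) (eval ![x, y] (pderiv 1 p)) y := by
    simpa using hasDerivAt_eval_fin_two p (hasDerivAt_const y x) (hasDerivAt_id y)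
  have hcont : Continuous fun y : ℝ => eval ![x, y] (pderiv 1 p) :=
    continuous_eval_fin_two _ continuous_const continuous_id
  rw [intervalIntegral.integral_eq_sub_of_hasDerivAt (fun y _ => hderiv y)
    (hcont.intervalIntegrable _ _), h x (1 - x), h x 0, sub_zero]
  · exact ⟨hx.1, le_rfl, by linarith [hx.2], Or.inr (Or.inl rfl)⟩
  · exact ⟨hx.1, by linarith [hx.2], by linarith, Or.inr (Or.inr (by ring))⟩

/-- The integral over the reference triangle of `∂₁ p` vanishes if `p` vanishes on the
boundary. -/
theorem setIntegral_Tref_pderiv_zero (p : MvPolynomial (Fin 2) ℝ)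
    (h : ∀ x y : ℝ, OnBdryT x y → eval ![x, y] p = 0) :
    ∫ q in Tref, eval ![q.1, q.2] (pderiv 0 p) = 0 := by
  rw [← setIntegral_Tref_swap]
  refine setIntegral_Tref_eq_zero (continuous_eval_fin_two _ continuous_snd continuous_fst)
    fun y hy => ?_
  have hderiv (x : ℝ) : HasDerivAt (fun s => eval ![s, y] p) (eval ![x, y] (pderiv 0 p)) x := by
    simpa using hasDerivAt_eval_fin_two p (hasDerivAt_id x) (hasDerivAt_const x y)
  have hcont : Continuous fun x : ℝ => eval ![x, y] (pderiv 0 p) :=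
    continuous_eval_fin_two _ continuous_id continuous_const
  simp only [Prod.swap_prod_mk]
  rw [intervalIntegral.integral_eq_sub_of_hasDerivAt (fun x _ => hderiv x)
    (hcont.intervalIntegrable _ _), h (1 - y) y, h 0 y, sub_zero]
  · exact ⟨le_rfl, hy.1, by linarith [hy.2], Or.inl rfl⟩
  · exact ⟨by linarith [hy.2], hy.1, by linarith, Or.inr (Or.inr (by ring))⟩

/-- Both partial derivatives of a polynomial vanishing on the boundary of the reference triangle
vanish at its vertices. -/
theorem eval_pderiv_vertices_eq_zero (p : MvPolynomial (Fin 2) ℝ)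
    (h : ∀ x y : ℝ, OnBdryT x y → eval ![x, y] p = 0) (i : Fin 2) :
    eval ![0, 0] (pderiv i p) = 0 ∧ eval ![1, 0] (pderiv i p) = 0 ∧
      eval ![0, 1] (pderiv i p) = 0 := by
  have h00x := directional_deriv_eq_zero p 0 0 1 0 fun t ht => h _ _
    ⟨by linarith [ht.1], by simp, by linarith [ht.2], Or.inr (Or.inl (by ring))⟩
  have h00y := directional_deriv_eq_zero p 0 0 0 1 fun t ht => h _ _
    ⟨by simp, by linarith [ht.1], by linarith [ht.2], Or.inl (by ring)⟩
  have h10x := directional_deriv_eq_zero p 1 0 (-1) 0 fun t ht => h _ _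
    ⟨by linarith [ht.2], by simp, by linarith [ht.1], Or.inr (Or.inl (by ring))⟩
  have h10d := directional_deriv_eq_zero p 1 0 (-1) 1 fun t ht => h _ _
    ⟨by linarith [ht.2], by linarith [ht.1], by linarith, Or.inr (Or.inr (by ring))⟩
  have h01y := directional_deriv_eq_zero p 0 1 0 (-1) fun t ht => h _ _
    ⟨by simp, by linarith [ht.2], by linarith [ht.1], Or.inl (by ring)⟩
  have h01d := directional_deriv_eq_zero p 0 1 1 (-1) fun t ht => h _ _
    ⟨by linarith [ht.1], by linarith [ht.2], by linarith, Or.inr (Or.inr (by ring))⟩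
  fin_cases i <;> dsimp only [Fin.zero_eta, Fin.mk_one] <;> refine ⟨?_, ?_, ?_⟩ <;> linarith

/-- If `k ≥ 1` and `v = (v₁,v₂)` is a pair of polynomials of total degree at most `k`
vanishing at every point of the boundary of the reference triangle, then
`div v = ∂₁v₁ + ∂₂v₂` belongs to `M^{k−1}(T̂)`: it has total degree at most `k − 1`,
vanishes at the three vertices `(0,0)`, `(1,0)`, `(0,1)`, and has zero integral over the
reference triangle. -/
theorem div_mem_Mspace (k : ℕ) (hk : 1 ≤ k) (v₁ v₂ : MvPolynomial (Fin 2) ℝ)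
    (hv₁ : v₁.totalDegree ≤ k) (hv₂ : v₂.totalDegree ≤ k)
    (hbd : ∀ x y : ℝ, OnBdryT x y → eval ![x, y] v₁ = 0 ∧ eval ![x, y] v₂ = 0) :
    (pderiv (0 : Fin 2) v₁ + pderiv (1 : Fin 2) v₂).totalDegree ≤ k - 1 ∧
    eval ![0, 0] (pderiv (0 : Fin 2) v₁ + pderiv (1 : Fin 2) v₂) = 0 ∧
    eval ![1, 0] (pderiv (0 : Fin 2) v₁ + pderiv (1 : Fin 2) v₂) = 0 ∧
    eval ![0, 1] (pderiv (0 : Fin 2) v₁ + pderiv (1 : Fin 2) v₂) = 0 ∧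
    (∫ p in Tref, eval ![p.1, p.2] (pderiv (0 : Fin 2) v₁ + pderiv (1 : Fin 2) v₂)) = 0 := by
  have h₁ : ∀ x y : ℝ, OnBdryT x y → eval ![x, y] v₁ = 0 := fun x y hxy => (hbd x y hxy).1
  have h₂ : ∀ x y : ℝ, OnBdryT x y → eval ![x, y] v₂ = 0 := fun x y hxy => (hbd x y hxy).2
  obtain ⟨a₁, b₁, c₁⟩ := eval_pderiv_vertices_eq_zero v₁ h₁ 0
  obtain ⟨a₂, b₂, c₂⟩ := eval_pderiv_vertices_eq_zero v₂ h₂ 1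
  refine ⟨?_, by rw [map_add, a₁, a₂, add_zero], by rw [map_add, b₁, b₂, add_zero],
    by rw [map_add, c₁, c₂, add_zero], ?_⟩
  · exact (totalDegree_add _ _).trans (max_le
      ((totalDegree_pderiv_le _ _).trans (Nat.sub_le_sub_right hv₁ 1))
      ((totalDegree_pderiv_le _ _).trans (Nat.sub_le_sub_right hv₂ 1)))
  · simp only [map_add]
    rw [integral_add (integrableOn_Tref (continuous_eval_fin_two _ continuous_fst continuous_snd))
      (integrableOn_Tref (continuous_eval_fin_two _ continuous_fst continuous_snd)), setIntegral_Tref_pderiv_zero v₁ h₁,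
      setIntegral_Tref_pderiv_one v₂ h₂, add_zero]
end

section
/- Let v = (v₁,v₂) be a pair of real polynomials in two variables, each of total degree at most 4, such that v vanishes at every point of the boundary ∂T̂ of the reference triangle and ∂₁v₁ + ∂₂v₂ = 0 identically. Then v₁ = v₂ = 0. Equivalently, Z^k(T̂) = {0} for all k ≤ 4. -/
open MvPolynomial

/-- The exponent of the bivariate monomial `x ^ i * y ^ j`. -/
noncomputable def expPair (i j : ℕ) : Fin 2 →₀ ℕ :=
  Finsupp.single 0 i + Finsupp.single 1 j

@[simp]
lemma expPair_zero (i j : ℕ) : expPair i j 0 = i := by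
  simp [expPair]

@[simp]
lemma expPair_one (i j : ℕ) : expPair i j 1 = j := by
  simp [expPair]

lemma expPair_apply (d : Fin 2 →₀ ℕ) : expPair (d 0) (d 1) = d := by
  ext k
  fin_cases k <;> simp

lemma coeff_expPair_eq_zero {R : Type*} [CommSemiring R] {p : MvPolynomial (Fin 2) R} {n i j : ℕ}
    (hp : p.totalDegree ≤ n) (hij : n < i + j) : coeff (expPair i j) p = 0 := by
  by_contra h
  have hle := le_totalDegree (mem_support_iff.2 h)
  rw [Finsupp.sum_fintype _ _ (fun _ => rfl), Fin.sum_univ_two, expPair_zero, expPair_one] at hle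
  omega

/-- Evaluation of a bivariate polynomial of total degree at most `n` as an explicit double sum. -/
lemma eval_eq_sum_expPair {R : Type*} [CommSemiring R] {p : MvPolynomial (Fin 2) R} {n : ℕ}
    (hp : p.totalDegree ≤ n) (x y : R) :
    eval ![x, y] p = ∑ i ∈ Finset.range (n + 1), ∑ j ∈ Finset.range (n + 1),
      coeff (expPair i j) p * (x ^ i * y ^ j) := by
  rw [eval_eq', ← Finset.sum_product']
  refine Finset.sum_of_injOn (fun d => (d 0, d 1)) ?_ ?_ ?_ ?_
  · intro d _ e _ h
    simp only [Prod.mk.injEq] at h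
    rw [← expPair_apply d, ← expPair_apply e, h.1, h.2]
  · intro d hd
    have hne : coeff (expPair (d 0) (d 1)) p ≠ 0 := by
      rw [expPair_apply]
      exact mem_support_iff.1 hd
    have hle : d 0 + d 1 ≤ n := not_lt.1 fun h => hne (coeff_expPair_eq_zero hp h)
    simp only [Finset.coe_product, Set.mem_prod, Finset.mem_coe, Finset.mem_range]
    omega
  · rintro ⟨i, j⟩ _ hij
    have : expPair i j ∉ p.support := fun h => hij ⟨expPair i j, h, by simp⟩
    simp [notMem_support_iff.1 this]
  · intro d _
    simp [expPair_apply, Fin.prod_univ_two]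

/-- A bivariate polynomial vanishes as soon as all its coefficients of degree at most a bound of
its total degree do. -/
lemma eq_zero_of_coeff_expPair {R : Type*} [CommSemiring R] {p : MvPolynomial (Fin 2) R} {n : ℕ}
    (hp : p.totalDegree ≤ n) (h : ∀ i j, i + j ≤ n → coeff (expPair i j) p = 0) : p = 0 := by
  ext d
  rw [← expPair_apply d, coeff_zero]
  rcases le_or_gt (d 0 + d 1) n with hd | hd
  · exact h _ _ hd
  · exact coeff_expPair_eq_zero hp hd

lemma coeff_expPair_pderiv_zero {R : Type*} [CommSemiring R] (p : MvPolynomial (Fin 2) R)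
    (i j : ℕ) : coeff (expPair i j) (pderiv 0 p) = coeff (expPair (i + 1) j) p * (i + 1) := by
  have h : expPair i j + Finsupp.single 0 1 = expPair (i + 1) j := by
    ext k
    fin_cases k <;> simp
  rw [coeff_pderiv, h, expPair_zero]

lemma coeff_expPair_pderiv_one {R : Type*} [CommSemiring R] (p : MvPolynomial (Fin 2) R)
    (i j : ℕ) : coeff (expPair i j) (pderiv 1 p) = coeff (expPair i (j + 1)) p * (j + 1) := by
  have h : expPair i j + Finsupp.single 1 1 = expPair i (j + 1) := by
    ext k
    fin_cases k <;> simp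
  rw [coeff_pderiv, h, expPair_one]

/-- A quartic vanishing on the boundary of the reference triangle has no pure powers, and its
remaining six coefficients satisfy three linear relations. -/
lemma coeff_of_vanish_on_bdry {p : MvPolynomial (Fin 2) ℝ} (hp : p.totalDegree ≤ 4)
    (h : ∀ x y : ℝ, OnBdryT x y → eval ![x, y] p = 0) :
    (∀ i ≤ 4, coeff (expPair i 0) p = 0) ∧ (∀ j ≤ 4, coeff (expPair 0 j) p = 0) ∧
    coeff (expPair 1 3) p = -(coeff (expPair 1 1) p + coeff (expPair 1 2) p) ∧
    coeff (expPair 3 1) p = -(coeff (expPair 1 1) p + coeff (expPair 2 1) p) ∧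
    coeff (expPair 2 2) p =
      -(2 * coeff (expPair 1 1) p + coeff (expPair 1 2) p + coeff (expPair 2 1) p) := by
  have hv : ∀ i j, 4 < i + j → coeff (expPair i j) p = 0 := fun i j => coeff_expPair_eq_zero hp
  have hE : ∀ x y : ℝ, OnBdryT x y → ∑ i ∈ Finset.range 5, ∑ j ∈ Finset.range 5,
      coeff (expPair i j) p * (x ^ i * y ^ j) = 0 := fun x y hxy => by
    rw [← eval_eq_sum_expPair hp]
    exact h x y hxy
  simp only [Finset.sum_range_succ, Finset.sum_range_zero, zero_add, hv 1 4 (by norm_num),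
    hv 2 3 (by norm_num), hv 2 4 (by norm_num), hv 3 2 (by norm_num), hv 3 3 (by norm_num),
    hv 3 4 (by norm_num), hv 4 1 (by norm_num), hv 4 2 (by norm_num), hv 4 3 (by norm_num),
    hv 4 4 (by norm_num), zero_mul, add_zero] at hE
  have h00 := hE 0 0 (by norm_num [OnBdryT])
  have hx1 := hE (1 / 4) 0 (by norm_num [OnBdryT])
  have hx2 := hE (1 / 2) 0 (by norm_num [OnBdryT])
  have hx3 := hE (3 / 4) 0 (by norm_num [OnBdryT])
  have hx4 := hE 1 0 (by norm_num [OnBdryT])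
  have hy1 := hE 0 (1 / 4) (by norm_num [OnBdryT])
  have hy2 := hE 0 (1 / 2) (by norm_num [OnBdryT])
  have hy3 := hE 0 (3 / 4) (by norm_num [OnBdryT])
  have hy4 := hE 0 1 (by norm_num [OnBdryT])
  have hd1 := hE (1 / 4) (3 / 4) (by norm_num [OnBdryT])
  have hd2 := hE (1 / 2) (1 / 2) (by norm_num [OnBdryT])
  have hd3 := hE (3 / 4) (1 / 4) (by norm_num [OnBdryT])
  norm_num at h00 hx1 hx2 hx3 hx4 hy1 hy2 hy3 hy4
  have hx : ∀ i ≤ 4, coeff (expPair i 0) p = 0 := by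
    intro i hi
    interval_cases i <;> linarith
  have hy : ∀ j ≤ 4, coeff (expPair 0 j) p = 0 := by
    intro j hj
    interval_cases j <;> linarith
  simp only [hx 0 (by norm_num), hx 1 (by norm_num), hx 2 (by norm_num), hx 3 (by norm_num),
    hx 4 (by norm_num), hy 1 (by norm_num), hy 2 (by norm_num), hy 3 (by norm_num),
    hy 4 (by norm_num)] at hd1 hd2 hd3
  exact ⟨hx, hy, by linarith, by linarith, by linarith⟩

/-- If `v = (v₁,v₂)` is a pair of polynomials of total degree at most `4` that vanishes at
every point of the boundary of the reference triangle and satisfies `∂₁v₁ + ∂₂v₂ = 0`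
identically, then `v₁ = v₂ = 0`; i.e. `Z^k(T̂) = {0}` for all `k ≤ 4`. -/
theorem Zspace_eq_bot_of_le_four (v₁ v₂ : MvPolynomial (Fin 2) ℝ)
    (hv₁ : v₁.totalDegree ≤ 4) (hv₂ : v₂.totalDegree ≤ 4)
    (hbd : ∀ x y : ℝ, OnBdryT x y → eval ![x, y] v₁ = 0 ∧ eval ![x, y] v₂ = 0)
    (hdiv : pderiv (0 : Fin 2) v₁ + pderiv (1 : Fin 2) v₂ = 0) :
    v₁ = 0 ∧ v₂ = 0 := by
  obtain ⟨hx₁, hy₁, h13₁, h31₁, h22₁⟩ := coeff_of_vanish_on_bdry hv₁ fun x y h => (hbd x y h).1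
  obtain ⟨hx₂, hy₂, h13₂, h31₂, h22₂⟩ := coeff_of_vanish_on_bdry hv₂ fun x y h => (hbd x y h).2
  have hD : ∀ i j : ℕ, coeff (expPair (i + 1) j) v₁ * (i + 1) +
      coeff (expPair i (j + 1)) v₂ * (j + 1) = 0 := fun i j => by
    rw [← coeff_expPair_pderiv_zero, ← coeff_expPair_pderiv_one, ← coeff_add, hdiv, coeff_zero]
  have d01 := hD 0 1
  have d10 := hD 1 0
  have d02 := hD 0 2
  have d11 := hD 1 1
  have d20 := hD 2 0
  have d03 := hD 0 3
  have d12 := hD 1 2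
  have d21 := hD 2 1
  have d30 := hD 3 0
  norm_num [hx₁, hy₁, hx₂, hy₂] at d01 d10 d02 d11 d20 d03 d12 d21 d30
  constructor
  · refine eq_zero_of_coeff_expPair hv₁ fun i j hij => ?_
    rcases Nat.eq_zero_or_pos i with rfl | hi
    · exact hy₁ j (by omega)
    rcases Nat.eq_zero_or_pos j with rfl | hj
    · exact hx₁ i (by omega)
    have hi3 : i ≤ 3 := by omega
    have hj3 : j ≤ 3 := by omega
    interval_cases i <;> interval_cases j <;> first | omega | linarith
  · refine eq_zero_of_coeff_expPair hv₂ fun i j hij => ?_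
    rcases Nat.eq_zero_or_pos i with rfl | hi
    · exact hy₂ j (by omega)
    rcases Nat.eq_zero_or_pos j with rfl | hj
    · exact hx₂ i (by omega)
    have hi3 : i ≤ 3 := by omega
    have hj3 : j ≤ 3 := by omega
    interval_cases i <;> interval_cases j <;> first | omega | linarith
end
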